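/- Explicit stabilizer decomposition of the R_y family: for every θ ∈ (0, π/2), the state ρ_θ = |ψ_θ⟩⟨ψ_θ| with |ψ_θ⟩ = cos(θ/2)|00⟩ + sin(θ/2)|11⟩ satisfies the matrix identity ρ_θ = cos θ·|00⟩⟨00| + ((1 − cos θ + sin θ)/2)·|+_L⟩⟨+_L| − ((cos θ + sin θ − 1)/2)·|−_L⟩⟨−_L|, where |±_L⟩ = (1/√2)(|00⟩ ± |11⟩); each of the three projections |00⟩⟨00|, |+_L⟩⟨+_L|, |−_L⟩⟨−_L| is a pure two-qubit stabilizer state, the coefficients have total absolute value cos θ + sin θ, and consequently Γ(ρ_θ) ≤ cos θ + sin θ. -/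

import Mathlib

open Matrix Kronecker Finset
open scoped ComplexOrder

noncomputable section

def PX : Matrix (Fin 2) (Fin 2) ℂ := !![0, 1; 1, 0]
def PY : Matrix (Fin 2) (Fin 2) ℂ := !![0, -Complex.I; Complex.I, 0]
def PZ : Matrix (Fin 2) (Fin 2) ℂ := !![1, 0; 0, -1]

/-- The single-qubit phase-point operator `A_{(q,p)}`. -/
def A1 (a : ZMod 2 × ZMod 2) : Matrix (Fin 2) (Fin 2) ℂ :=
  (1 / 2 : ℂ) • ((1 : Matrix (Fin 2) (Fin 2) ℂ)
    + ((-1 : ℂ) ^ a.2.val) • PX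
    + ((-1 : ℂ) ^ (a.1.val + a.2.val)) • PY
    + ((-1 : ℂ) ^ a.1.val) • PZ)

def pauli : Fin 4 → Matrix (Fin 2) (Fin 2) ℂ := ![1, PX, PY, PZ]

/-- A density matrix: positive semidefinite with unit trace. -/
def IsDensity {d : ℕ} (ρ : Matrix (Fin d) (Fin d) ℂ) : Prop :=
  ρ.PosSemidef ∧ ρ.trace = 1

/-- Kronecker product of 2×2 matrices as a 4×4 matrix. -/
def kron2 (M N : Matrix (Fin 2) (Fin 2) ℂ) : Matrix (Fin 4) (Fin 4) ℂ :=
  Matrix.reindex (finProdFinEquiv.trans (finCongr (by norm_num)))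
    (finProdFinEquiv.trans (finCongr (by norm_num))) (M ⊗ₖ N)

/-- The two-qubit phase-point operator `A_α = A_{α₁} ⊗ A_{α₂}`. -/
def A2 (α : (ZMod 2 × ZMod 2) × (ZMod 2 × ZMod 2)) : Matrix (Fin 4) (Fin 4) ℂ :=
  kron2 (A1 α.1) (A1 α.2)

/-- The two-qubit Pauli group `P₂`. -/
def Pauli2 : Set (Matrix (Fin 4) (Fin 4) ℂ) :=
  { M | ∃ (k : Fin 4) (P Q : Fin 4), M = Complex.I ^ (k : ℕ) • kron2 (pauli P) (pauli Q) }

/-- `S` is an abelian subgroup of `P₂` with `|S| = 4` and `-I ∉ S`. -/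
def IsStabGroup2 (S : Finset (Matrix (Fin 4) (Fin 4) ℂ)) : Prop :=
  (∀ g ∈ S, g ∈ Pauli2) ∧ (1 : Matrix (Fin 4) (Fin 4) ℂ) ∈ S ∧
  (∀ g ∈ S, ∀ h ∈ S, g * h ∈ S ∧ g * h = h * g) ∧
  S.card = 4 ∧ (-1 : Matrix (Fin 4) (Fin 4) ℂ) ∉ S

/-- The pure two-qubit stabilizer states. -/
def Stab2 : Set (Matrix (Fin 4) (Fin 4) ℂ) :=
  { σ | ∃ S : Finset (Matrix (Fin 4) (Fin 4) ℂ),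
      IsStabGroup2 S ∧ σ = (4 : ℂ)⁻¹ • ∑ g ∈ S, g }

/-- Two-qubit discrete Wigner function (of any 4×4 matrix). -/
def W2 (ρ : Matrix (Fin 4) (Fin 4) ℂ) (α : (ZMod 2 × ZMod 2) × (ZMod 2 × ZMod 2)) : ℝ :=
  ((4 : ℂ)⁻¹ * (ρ * A2 α).trace).re

/-- Two-qubit free Wigner polytope. -/
def WFree2 : Set (((ZMod 2 × ZMod 2) × (ZMod 2 × ZMod 2)) → ℝ) :=
  convexHull ℝ { w | ∃ σ ∈ Stab2, w = W2 σ }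

/-- Two-qubit Wigner distance `C(ρ)`. -/
def C2 (ρ : Matrix (Fin 4) (Fin 4) ℂ) : ℝ :=
  sInf { d | ∃ f ∈ WFree2, d = ∑ α, |W2 ρ α - f α| }

/-- Two-qubit stabilizer extent `Γ(ρ)`. -/
def Gam2 (ρ : Matrix (Fin 4) (Fin 4) ℂ) : ℝ :=
  sInf { t | ∃ (k : ℕ) (a : Fin k → ℝ) (s : Fin k → Matrix (Fin 4) (Fin 4) ℂ),
      (∀ i, s i ∈ Stab2) ∧ ρ = ∑ i, a i • s i ∧ t = ∑ i, |a i| }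

/-- Rank-one projection `|ψ⟩⟨ψ|`. -/
def proj (ψ : Fin 4 → ℂ) : Matrix (Fin 4) (Fin 4) ℂ :=
  Matrix.vecMulVec ψ fun j => (starRingEnd ℂ) (ψ j)

/-- The basis vector `|00⟩`. -/
def e0 : Fin 4 → ℂ := fun i => if i = 0 then 1 else 0

/-- The basis vector `|11⟩`. -/
def e3 : Fin 4 → ℂ := fun i => if i = 3 then 1 else 0

/-- `|ψ_θ⟩ = cos(θ/2)|00⟩ + sin(θ/2)|11⟩` (the R_y family). -/
def psiRy (θ : ℝ) : Fin 4 → ℂ := fun i =>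
  if i = 0 then ((Real.cos (θ / 2) : ℝ) : ℂ)
  else if i = 3 then ((Real.sin (θ / 2) : ℝ) : ℂ) else 0

/-- `|ψ_θ⟩ = cos(θ/2)|00⟩ − i sin(θ/2)|11⟩` (the R_x family). -/
def psiRx (θ : ℝ) : Fin 4 → ℂ := fun i =>
  if i = 0 then ((Real.cos (θ / 2) : ℝ) : ℂ)
  else if i = 3 then -Complex.I * ((Real.sin (θ / 2) : ℝ) : ℂ) else 0

/-- `|Φ_θ⟩ = (1/√2)(|00⟩ + e^{iθ}|11⟩)` (the Bell+R_z family). -/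
def psiB (θ : ℝ) : Fin 4 → ℂ := fun i =>
  if i = 0 then (((Real.sqrt 2 : ℝ) : ℂ))⁻¹
  else if i = 3 then Complex.exp (θ * Complex.I) / ((Real.sqrt 2 : ℝ) : ℂ) else 0

/-- `|+_L⟩ = (1/√2)(|00⟩ + |11⟩)`. -/
def pPlus : Fin 4 → ℂ := fun i =>
  if i = 0 then (((Real.sqrt 2 : ℝ) : ℂ))⁻¹
  else if i = 3 then (((Real.sqrt 2 : ℝ) : ℂ))⁻¹ else 0

/-- `|−_L⟩ = (1/√2)(|00⟩ − |11⟩)`. -/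
def pMinus : Fin 4 → ℂ := fun i =>
  if i = 0 then (((Real.sqrt 2 : ℝ) : ℂ))⁻¹
  else if i = 3 then -(((Real.sqrt 2 : ℝ) : ℂ))⁻¹ else 0

lemma kron2_fin_two (a b c d e f g h : ℂ) :
    kron2 !![a, b; c, d] !![e, f; g, h] =
      !![a * e, a * f, b * e, b * f;
         a * g, a * h, b * g, b * h;
         c * e, c * f, d * e, d * f;
         c * g, c * h, d * g, d * h] := by
  ext i j
  fin_cases i <;> fin_cases j <;> rfl

lemma kron2_mem_Pauli2 (P Q : Fin 4) : kron2 (pauli P) (pauli Q) ∈ Pauli2 :=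
  ⟨0, P, Q, by simp⟩

lemma neg_kron2_mem_Pauli2 (P Q : Fin 4) : -kron2 (pauli P) (pauli Q) ∈ Pauli2 :=
  ⟨2, P, Q, by simp⟩

lemma kron2_mul (M N M' N' : Matrix (Fin 2) (Fin 2) ℂ) :
    kron2 M N * kron2 M' N' = kron2 (M * M') (N * N') := by
  simp [kron2, Matrix.submatrix_mul_equiv, Matrix.mul_kronecker_mul]

lemma kron2_one_one : kron2 1 1 = 1 := by
  simp [kron2]

lemma one_mem_Pauli2 : (1 : Matrix (Fin 4) (Fin 4) ℂ) ∈ Pauli2 :=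
  kron2_one_one ▸ kron2_mem_Pauli2 0 0

lemma mem_Stab2_of_generators {A B : Matrix (Fin 4) (Fin 4) ℂ}
    (hA : A ∈ Pauli2) (hB : B ∈ Pauli2) (hAB : A * B ∈ Pauli2)
    (hAA : A * A = 1) (hBB : B * B = 1) (comm : A * B = B * A)
    (hA1 : A ≠ 1) (hB1 : B ≠ 1) (hne : A ≠ B)
    (hA1' : A ≠ -1) (hB1' : B ≠ -1) (hne' : A ≠ -B) :
    (4 : ℂ)⁻¹ • (1 + A + B + A * B) ∈ Stab2 := by
  classical
  have cancel {C : Matrix (Fin 4) (Fin 4) ℂ} (h : A * B = C) : A = C * B := by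
    rw [← h, mul_assoc, hBB, mul_one]
  have cancel' {C : Matrix (Fin 4) (Fin 4) ℂ} (h : A * B = C) : B = A * C := by
    rw [← h, ← mul_assoc, hAA, one_mul]
  have h1 : A * B ≠ 1 := fun h => hne (by simpa using cancel h)
  have h2 : A * B ≠ A := fun h => hB1 (by simpa [hAA] using cancel' h)
  have h3 : A * B ≠ B := fun h => hA1 (by simpa [hBB] using cancel h)
  have h4 : A * B ≠ -1 := fun h => hne' (by simpa using cancel h)
  have h5 : (-1 : Matrix (Fin 4) (Fin 4) ℂ) ≠ 1 := fun h => by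
    have := congrFun (congrFun h 0) 0
    norm_num at this
  have mulA : A * (A * B) = B := by rw [← mul_assoc, hAA, one_mul]
  have mulB : B * (A * B) = A := by rw [comm, ← mul_assoc, hBB, one_mul]
  have mulA' : A * B * A = B := by rw [comm, mul_assoc, hAA, mul_one]
  have mulB' : A * B * B = A := by rw [mul_assoc, hBB, mul_one]
  have mulAB : A * B * (A * B) = 1 := by rw [mul_assoc, mulB, hAA]
  refine ⟨{1, A, B, A * B}, ⟨?_, by simp, ?_, ?_, ?_⟩, ?_⟩
  · simp only [mem_insert, mem_singleton]
    rintro g (rfl | rfl | rfl | rfl)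
    exacts [one_mem_Pauli2, hA, hB, hAB]
  · simp only [mem_insert, mem_singleton]
    rintro g (hg | hg | hg | hg) h (hh | hh | hh | hh) <;> rw [hg, hh] <;>
      simp only [one_mul, mul_one, mulA, mulB, mulA', mulB', mulAB, hAA, hBB, ← comm,
        true_or, or_true, and_self]
  · rw [card_insert_of_notMem, card_insert_of_notMem, card_insert_of_notMem, card_singleton] <;>
      simp [hA1.symm, hB1.symm, hne, h1.symm, h2.symm, h3.symm]
  · simp [hA1'.symm, hB1'.symm, h4.symm, h5]
  · rw [sum_insert, sum_insert, sum_insert, sum_singleton]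
    · simp only [add_assoc]
    all_goals simp [hA1.symm, hB1.symm, hne, h1.symm, h2.symm, h3.symm]

lemma PX_mul_PX : PX * PX = 1 := by
  simp [PX, Matrix.one_fin_two]

lemma PZ_mul_PZ : PZ * PZ = 1 := by
  simp [PZ, Matrix.one_fin_two]

lemma kron2_PZ_one : kron2 PZ 1 = diagonal ![1, 1, -1, -1] := by
  rw [PZ, Matrix.one_fin_two, kron2_fin_two]
  ext i j
  fin_cases i <;> fin_cases j <;> simp

lemma kron2_one_PZ : kron2 1 PZ = diagonal ![1, -1, 1, -1] := by
  rw [PZ, Matrix.one_fin_two, kron2_fin_two]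
  ext i j
  fin_cases i <;> fin_cases j <;> simp

lemma kron2_PZ_PZ : kron2 PZ PZ = diagonal ![1, -1, -1, 1] := by
  rw [PZ, kron2_fin_two]
  ext i j
  fin_cases i <;> fin_cases j <;> simp

lemma kron2_PX_PX : kron2 PX PX = !![0, 0, 0, 1; 0, 0, 1, 0; 0, 1, 0, 0; 1, 0, 0, 0] := by
  rw [PX, kron2_fin_two]
  simp

lemma kron2_PY_PY : kron2 PY PY = !![0, 0, 0, -1; 0, 0, 1, 0; 0, 1, 0, 0; -1, 0, 0, 0] := by
  rw [PY, kron2_fin_two]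
  simp

lemma kron2_PX_PX_mul_kron2_PZ_PZ : kron2 PX PX * kron2 PZ PZ = -kron2 PY PY := by
  rw [kron2_PX_PX, kron2_PZ_PZ, kron2_PY_PY]
  ext i j
  fin_cases i <;> fin_cases j <;> simp

lemma kron2_PZ_PZ_mul_kron2_PX_PX : kron2 PZ PZ * kron2 PX PX = -kron2 PY PY := by
  rw [kron2_PX_PX, kron2_PZ_PZ, kron2_PY_PY]
  ext i j
  fin_cases i <;> fin_cases j <;> simp

lemma inv_sqrt_two_mul_self :
    (((Real.sqrt 2 : ℝ) : ℂ))⁻¹ * (((Real.sqrt 2 : ℝ) : ℂ))⁻¹ = 2⁻¹ := by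
  rw [← mul_inv, ← Complex.ofReal_mul, Real.mul_self_sqrt (by norm_num)]
  norm_num

lemma proj_e0 : proj e0 = !![1, 0, 0, 0; 0, 0, 0, 0; 0, 0, 0, 0; 0, 0, 0, 0] := by
  ext i j
  fin_cases i <;> fin_cases j <;> simp [proj, e0, vecMulVec_apply]

lemma proj_pPlus :
    proj pPlus = !![2⁻¹, 0, 0, 2⁻¹; 0, 0, 0, 0; 0, 0, 0, 0; 2⁻¹, 0, 0, 2⁻¹] := by
  ext i j
  fin_cases i <;> fin_cases j <;>
    simp [proj, pPlus, vecMulVec_apply, inv_sqrt_two_mul_self]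

lemma proj_pMinus :
    proj pMinus = !![2⁻¹, 0, 0, -2⁻¹; 0, 0, 0, 0; 0, 0, 0, 0; -2⁻¹, 0, 0, 2⁻¹] := by
  ext i j
  fin_cases i <;> fin_cases j <;>
    simp [proj, pMinus, vecMulVec_apply, inv_sqrt_two_mul_self]

lemma proj_e0_mem_Stab2 : proj e0 ∈ Stab2 := by
  have h : proj e0 =
      (4 : ℂ)⁻¹ • (1 + kron2 PZ 1 + kron2 1 PZ + kron2 PZ 1 * kron2 1 PZ) := by
    rw [proj_e0, kron2_PZ_one, kron2_one_PZ]
    ext i j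
    fin_cases i <;> fin_cases j <;> norm_num [Matrix.one_apply]
  rw [h]
  refine mem_Stab2_of_generators (kron2_mem_Pauli2 3 0) (kron2_mem_Pauli2 0 3)
    ?_ ?_ ?_ ?_ ?_ ?_ ?_ ?_ ?_ ?_
  · rw [kron2_mul, mul_one, one_mul]
    exact kron2_mem_Pauli2 3 3
  · rw [kron2_mul, PZ_mul_PZ, mul_one, kron2_one_one]
  · rw [kron2_mul, PZ_mul_PZ, mul_one, kron2_one_one]
  · simp [kron2_mul]
  all_goals
    rw [Ne, ← Matrix.ext_iff]
    simp [kron2_PZ_one, kron2_one_PZ, Fin.forall_fin_succ, Matrix.one_apply]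
    try norm_num

lemma proj_pPlus_mem_Stab2 : proj pPlus ∈ Stab2 := by
  have h : proj pPlus =
      (4 : ℂ)⁻¹ • (1 + kron2 PX PX + kron2 PZ PZ + kron2 PX PX * kron2 PZ PZ) := by
    rw [kron2_PX_PX_mul_kron2_PZ_PZ, proj_pPlus, kron2_PX_PX, kron2_PZ_PZ, kron2_PY_PY]
    ext i j
    fin_cases i <;> fin_cases j <;> norm_num [Matrix.one_apply]
  rw [h]
  refine mem_Stab2_of_generators (kron2_mem_Pauli2 1 1) (kron2_mem_Pauli2 3 3)
    ?_ ?_ ?_ ?_ ?_ ?_ ?_ ?_ ?_ ?_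
  · rw [kron2_PX_PX_mul_kron2_PZ_PZ]
    exact neg_kron2_mem_Pauli2 2 2
  · rw [kron2_mul, PX_mul_PX, kron2_one_one]
  · rw [kron2_mul, PZ_mul_PZ, kron2_one_one]
  · rw [kron2_PX_PX_mul_kron2_PZ_PZ, kron2_PZ_PZ_mul_kron2_PX_PX]
  all_goals
    rw [Ne, ← Matrix.ext_iff]
    simp [kron2_PX_PX, kron2_PZ_PZ, Fin.forall_fin_succ, Matrix.one_apply]
    try norm_num

lemma proj_pMinus_mem_Stab2 : proj pMinus ∈ Stab2 := by
  have h : proj pMinus =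
      (4 : ℂ)⁻¹ • (1 + -kron2 PX PX + kron2 PZ PZ + -kron2 PX PX * kron2 PZ PZ) := by
    rw [neg_mul, kron2_PX_PX_mul_kron2_PZ_PZ, proj_pMinus, kron2_PX_PX, kron2_PZ_PZ, kron2_PY_PY]
    ext i j
    fin_cases i <;> fin_cases j <;> norm_num [Matrix.one_apply]
  rw [h]
  refine mem_Stab2_of_generators (neg_kron2_mem_Pauli2 1 1)
    (kron2_mem_Pauli2 3 3) ?_ ?_ ?_ ?_ ?_ ?_ ?_ ?_ ?_ ?_
  · rw [neg_mul, kron2_PX_PX_mul_kron2_PZ_PZ, neg_neg]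
    exact kron2_mem_Pauli2 2 2
  · rw [neg_mul_neg, kron2_mul, PX_mul_PX, kron2_one_one]
  · rw [kron2_mul, PZ_mul_PZ, kron2_one_one]
  · rw [neg_mul, mul_neg, kron2_PX_PX_mul_kron2_PZ_PZ, kron2_PZ_PZ_mul_kron2_PX_PX]
  all_goals
    rw [Ne, ← Matrix.ext_iff]
    simp [kron2_PX_PX, kron2_PZ_PZ, Fin.forall_fin_succ, Matrix.one_apply]
    try norm_num

lemma proj_psiRy (θ : ℝ) :
    proj (psiRy θ) =
      Real.cos θ • proj e0
        + ((1 - Real.cos θ + Real.sin θ) / 2) • proj pPlus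
        - ((Real.cos θ + Real.sin θ - 1) / 2) • proj pMinus := by
  obtain ⟨φ, rfl⟩ : ∃ φ, θ = 2 * φ := ⟨θ / 2, by ring⟩
  have hcs : ((Real.sin φ : ℝ) : ℂ) ^ 2 + ((Real.cos φ : ℝ) : ℂ) ^ 2 = 1 :=
    mod_cast Real.sin_sq_add_cos_sq φ
  rw [proj_e0, proj_pPlus, proj_pMinus, Real.cos_two_mul, Real.sin_two_mul]
  ext i j
  fin_cases i <;> fin_cases j <;>
    simp [proj, psiRy, vecMulVec_apply, -Complex.ofReal_cos, -Complex.ofReal_sin] <;>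
    first
    | ring1
    | linear_combination hcs

lemma Gam2_le {k : ℕ} {ρ : Matrix (Fin 4) (Fin 4) ℂ} (a : Fin k → ℝ)
    (s : Fin k → Matrix (Fin 4) (Fin 4) ℂ) (hs : ∀ i, s i ∈ Stab2)
    (hρ : ρ = ∑ i, a i • s i) : Gam2 ρ ≤ ∑ i, |a i| := by
  refine csInf_le ⟨0, ?_⟩ ⟨k, a, s, hs, hρ, rfl⟩
  rintro t ⟨k, a, s, -, -, rfl⟩
  exact sum_nonneg fun i _ => abs_nonneg _

/-- explicit stabilizer decomposition of the R_y family and the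
resulting upper bound `Γ(ρ_θ) ≤ cos θ + sin θ`. -/
theorem Ry_decomposition (θ : ℝ) (h0 : 0 < θ) (h2 : θ < Real.pi / 2) :
    proj (psiRy θ) =
      Real.cos θ • proj e0
        + ((1 - Real.cos θ + Real.sin θ) / 2) • proj pPlus
        - ((Real.cos θ + Real.sin θ - 1) / 2) • proj pMinus ∧
    proj e0 ∈ Stab2 ∧ proj pPlus ∈ Stab2 ∧ proj pMinus ∈ Stab2 ∧
    |Real.cos θ| + |(1 - Real.cos θ + Real.sin θ) / 2|
        + |(Real.cos θ + Real.sin θ - 1) / 2| = Real.cos θ + Real.sin θ ∧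
    Gam2 (proj (psiRy θ)) ≤ Real.cos θ + Real.sin θ := by
  have hc : 0 < Real.cos θ := Real.cos_pos_of_mem_Ioo ⟨by linarith, h2⟩
  have hs : 0 < Real.sin θ := Real.sin_pos_of_pos_of_lt_pi h0 (by linarith)
  have hcs : 1 ≤ Real.cos θ + Real.sin θ := by
    nlinarith [Real.sin_sq_add_cos_sq θ, mul_pos hc hs]
  have habs : |Real.cos θ| + |(1 - Real.cos θ + Real.sin θ) / 2|
      + |(Real.cos θ + Real.sin θ - 1) / 2| = Real.cos θ + Real.sin θ := by
    rw [abs_of_pos hc, abs_of_nonneg (by linarith [Real.cos_le_one θ]),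
      abs_of_nonneg (by linarith)]
    ring
  refine ⟨proj_psiRy θ, proj_e0_mem_Stab2, proj_pPlus_mem_Stab2, proj_pMinus_mem_Stab2, habs, ?_⟩
  refine (Gam2_le ![Real.cos θ, (1 - Real.cos θ + Real.sin θ) / 2,
    -((Real.cos θ + Real.sin θ - 1) / 2)] ![proj e0, proj pPlus, proj pMinus] ?_ ?_).trans_eq ?_
  · simp [Fin.forall_fin_succ, proj_e0_mem_Stab2, proj_pPlus_mem_Stab2, proj_pMinus_mem_Stab2]
  · rw [proj_psiRy, Fin.sum_univ_three, sub_eq_add_neg, ← neg_smul]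
    rfl
  · simpa only [Fin.sum_univ_three, Matrix.cons_val, abs_neg] using habs
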